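/- arXiv:1507.07368 — 2 statements merged into one kernel-verified Lean document; each statement's English description precedes it below -/
import Mathlib

section
/- Let r, s, k, q be positive integers with k ≤ r, d := r + s ≤ q. Let H₂ be a (q,r,k)-splitter. For each integer d' with ⌊r/k⌋ ≤ d' ≤ d, let H₃[d'] be a family of functions {1,…,q} → {0,1} such that for every set S ⊆ {1,…,q} with |S| = d' and every subset I ⊆ S with |I| ∈ {⌊r/k⌋, ⌈r/k⌉} there is h ∈ H₃[d'] with h(x) = 1 for all x ∈ I and h(x) = 0 for all x ∈ S \ I. For g ∈ H₂ and (h₁,…,h_k) ∈ H₃[d₁] × ⋯ × H₃[d_k], where d₁,…,d_k are integers with ⌊r/k⌋ ≤ d_i ≤ d and d₁ + ⋯ + d_k = d, define H_{h₁,…,h_k,g} : {1,…,q} → {0,1} by H_{h₁,…,h_k,g}(i) := h_{g(i)}(i). Then the set of all such functions H_{h₁,…,h_k,g} is a (q,(r,s))-cover-free family. -/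
/-- An `(n,(r,s))`-cover-free family (as a set of boolean vectors). -/
def IsCFF (n r s : ℕ) (F : Set (Fin n → Bool)) : Prop :=
  ∀ S : Finset (Fin n), S.card = r + s →
    ∀ J ⊆ S, J.card = r →
      ∃ a ∈ F, (∀ i ∈ J, a i = true) ∧ ∀ i ∈ S \ J, a i = false

/-- An `(n,r,k)`-splitter: for every `S` of size `r` some `h ∈ H` puts either
`⌊r/k⌋` or `⌈r/k⌉` elements of `S` in each bucket. -/
def IsSplitter (n r k : ℕ) (H : Finset (Fin n → Fin k)) : Prop :=
  ∀ S : Finset (Fin n), S.card = r → ∃ h ∈ H, ∀ j : Fin k,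
    (S.filter fun i => h i = j).card = r / k ∨
    (S.filter fun i => h i = j).card = (r + k - 1) / k

/-- The first construction: composing a `(q,r,k)`-splitter with families `H₃[d']`
(which separate, within any `d'` indices, any subset of size `⌊r/k⌋` or `⌈r/k⌉`),
over all choices of `d₁ + ⋯ + d_k = d`, gives a `(q,(r,s))`-CFF. -/
theorem first_construction_is_cff (r s k q : ℕ)
    (hr : 1 ≤ r) (hs : 1 ≤ s) (hk : 1 ≤ k) (hkr : k ≤ r) (hdq : r + s ≤ q)
    (H₂ : Finset (Fin q → Fin k)) (hH₂ : IsSplitter q r k H₂)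
    (H₃ : ℕ → Finset (Fin q → Bool))
    (hH₃ : ∀ d', r / k ≤ d' → d' ≤ r + s → ∀ S : Finset (Fin q), S.card = d' →
      ∀ I ⊆ S, (I.card = r / k ∨ I.card = (r + k - 1) / k) →
        ∃ h ∈ H₃ d', (∀ x ∈ I, h x = true) ∧ ∀ x ∈ S \ I, h x = false) :
    IsCFF q r s
      { H : Fin q → Bool | ∃ g ∈ H₂, ∃ ds : Fin k → ℕ, ∃ hs : Fin k → (Fin q → Bool),
          (∀ i, r / k ≤ ds i ∧ ds i ≤ r + s ∧ hs i ∈ H₃ (ds i)) ∧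
          (∑ i, ds i) = r + s ∧
          H = fun i => hs (g i) i } := by
  intro S hS J hJS hJ
  obtain ⟨g, hg, hsplit⟩ := hH₂ J hJ
  have hsub : ∀ j, (J.filter fun i => g i = j) ⊆ S.filter fun i => g i = j :=
    fun j => Finset.filter_subset_filter _ hJS
  have hfloor : r / k ≤ (r + k - 1) / k := Nat.div_le_div_right (by omega)
  have hlow : ∀ j, r / k ≤ (S.filter fun i => g i = j).card := by
    intro j
    have hle := Finset.card_le_card (hsub j)
    rcases hsplit j with h | h <;> omega
  have hup : ∀ j, (S.filter fun i => g i = j).card ≤ r + s := fun j =>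
    hS ▸ Finset.card_filter_le _ _
  choose h hmem hone hzero using fun j =>
    hH₃ _ (hlow j) (hup j) _ rfl _ (hsub j) (hsplit j)
  refine ⟨fun i => h (g i) i, ⟨g, hg, fun j => (S.filter fun i => g i = j).card, h,
    fun j => ⟨hlow j, hup j, hmem j⟩, ?_, rfl⟩, ?_, ?_⟩
  · rw [← hS]
    exact (Finset.card_eq_sum_card_fiberwise fun i _ => Finset.mem_univ (g i)).symm
  · intro i hi
    exact hone (g i) i (by simp [hi])
  · intro i hi
    rw [Finset.mem_sdiff] at hi
    exact hzero (g i) i (by simp [hi.1, hi.2])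
end

section
/- Fix positive integers n, k, t and, for each i ∈ {1,…,k}, positive integers ρ_{i,1}, ρ_{i,2} with ρ_{i,1} + ρ_{i,2} ≤ n and an integer q_i with q_i > 24·ρ_{i,1}ρ_{i,2}. Suppose for each i, H_i = {h_{i,1},…,h_{i,t}} is a 1/2-dense (n,q_i,(ρ_{i,1},ρ_{i,2}))-separating hash family of size exactly t, and G ⊆ {1,…,t}^k is a hitting set for combinatorial rectangles with sidewise density 1/3. For each g = (g₁,…,g_k) ∈ G and each choice of subsets R_i ⊆ {1,…,q_i} with |R_i| = ρ_{i,1} (i = 1,…,k), define h : {1,…,k} × {1,…,n} → {0,1} by h(i,j) = 1 if and only if h_{i,g_i}(j) ∈ R_i. Then the family of all such functions h is an (n,((ρ_{1,1},ρ_{1,2}),…,(ρ_{k,1},ρ_{k,2})))-multi-CFF. -/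
/-- Multi-CFF property for a set of functions `h : [k] × [n] → {0,1}`. -/
def IsMCFF (n k : ℕ) (ρ₁ ρ₂ : Fin k → ℕ) (H : Set (Fin k → Fin n → Bool)) : Prop :=
  ∀ S₁ S₂ : Fin k → Finset (Fin n),
    (∀ i, Disjoint (S₁ i) (S₂ i)) → (∀ i, (S₁ i).card = ρ₁ i) → (∀ i, (S₂ i).card = ρ₂ i) →
      ∃ h ∈ H, ∀ i, (∀ x ∈ S₁ i, h i x = true) ∧ ∀ x ∈ S₂ i, h i x = false

/-- Hitting set for combinatorial rectangles with sidewise density `γ` in `[t]^k`. -/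
def IsRectHitting (t k : ℕ) (γ : ℝ) (G : Finset (Fin k → Fin t)) : Prop :=
  ∀ R : Fin k → Finset (Fin t), (∀ i, γ * t ≤ ((R i).card : ℝ)) →
    ∃ v ∈ G, ∀ i, v i ∈ R i

/-- The second construction: given, for each `i`, an indexed `1/2`-dense
`(n,q_i,(ρ_{i,1},ρ_{i,2}))`-separating hash family `{h_{i,1},…,h_{i,t}}`
(functions into `{1,…,q_i}`) with `q_i > 24ρ_{i,1}ρ_{i,2}`, and a hitting set
`G ⊆ [t]^k` for rectangles of sidewise density `1/3`, the family of all functions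
`h(i,j) = 1 ↔ h_{i,g_i}(j) ∈ R_i` (over `g ∈ G` and `R_i ⊆ [q_i]`, `|R_i| = ρ_{i,1}`)
is an `(n,((ρ_{1,1},ρ_{1,2}),…,(ρ_{k,1},ρ_{k,2})))`-multi-CFF. -/
theorem mcff_construction (n k t : ℕ) (hn : 1 ≤ n) (hk : 1 ≤ k) (ht : 1 ≤ t)
    (ρ₁ ρ₂ : Fin k → ℕ) (hρ₁ : ∀ i, 1 ≤ ρ₁ i) (hρ₂ : ∀ i, 1 ≤ ρ₂ i)
    (hρn : ∀ i, ρ₁ i + ρ₂ i ≤ n)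
    (q : Fin k → ℕ) (hq : ∀ i, 24 * (ρ₁ i * ρ₂ i) < q i)
    (hashes : Fin k → Fin t → Fin n → ℕ)
    (hrange : ∀ i j x, hashes i j x ∈ Finset.Icc 1 (q i))
    (hdense : ∀ i, ∀ S₁ S₂ : Finset (Fin n), Disjoint S₁ S₂ →
      S₁.card = ρ₁ i → S₂.card = ρ₂ i →
      (1 - (1 : ℝ) / 2) * t ≤
        ((Finset.univ.filter fun j : Fin t =>
          Disjoint (S₁.image (hashes i j)) (S₂.image (hashes i j))).card : ℝ))
    (G : Finset (Fin k → Fin t)) (hG : IsRectHitting t k (1/3) G) :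
    IsMCFF n k ρ₁ ρ₂
      { h : Fin k → Fin n → Bool | ∃ g ∈ G, ∃ R : Fin k → Finset ℕ,
          (∀ i, R i ⊆ Finset.Icc 1 (q i)) ∧ (∀ i, (R i).card = ρ₁ i) ∧
          h = fun i j => decide (hashes i (g i) j ∈ R i) } := by
  intro S₁ S₂ hS hS₁ hS₂
  obtain ⟨g, hgG, hg⟩ := hG
    (fun i => Finset.univ.filter fun j : Fin t =>
      Disjoint ((S₁ i).image (hashes i j)) ((S₂ i).image (hashes i j)))
    (fun i => by
      have h := hdense i (S₁ i) (S₂ i) (hS i) (hS₁ i) (hS₂ i)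
      have : (0 : ℝ) ≤ t := Nat.cast_nonneg t
      linarith)
  have hR (i : Fin k) : ∃ R : Finset ℕ, (S₁ i).image (hashes i (g i)) ⊆ R ∧
      R ⊆ Finset.Icc 1 (q i) \ (S₂ i).image (hashes i (g i)) ∧ R.card = ρ₁ i := by
    have hdisj := (Finset.mem_filter.mp (hg i)).2
    apply Finset.exists_subsuperset_card_eq
    · exact Finset.subset_sdiff.mpr
        ⟨Finset.image_subset_iff.mpr fun x _ => hrange i (g i) x, hdisj⟩
    · exact Finset.card_image_le.trans_eq (hS₁ i)
    · have hle := Finset.le_card_sdiff ((S₂ i).image (hashes i (g i))) (Finset.Icc 1 (q i))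
      have him : ((S₂ i).image (hashes i (g i))).card ≤ ρ₂ i :=
        Finset.card_image_le.trans_eq (hS₂ i)
      have hcard := Nat.card_Icc 1 (q i)
      have hsum : ρ₁ i + ρ₂ i ≤ q i := by
        nlinarith [hq i, Nat.mul_le_mul_left (ρ₁ i) (hρ₂ i), Nat.mul_le_mul_right (ρ₂ i) (hρ₁ i)]
      omega
  choose R hSR hRq hRcard using hR
  refine ⟨_, ⟨g, hgG, R, fun i => (hRq i).trans Finset.sdiff_subset, hRcard, rfl⟩,
    fun i => ⟨fun x hx => ?_, fun x hx => ?_⟩⟩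
  · exact decide_eq_true (hSR i (Finset.mem_image_of_mem _ hx))
  · exact decide_eq_false fun h =>
      (Finset.mem_sdiff.mp (hRq i h)).2 (Finset.mem_image_of_mem _ hx)
end
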